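/- In U, for every 1 ≤ i ≤ N one has the supercommutator identities [𝓔_i, χ_i⁻] = 0 and [Ω(𝓔_i), χ_i⁺] = 0; explicitly, 𝓔_iχ_i⁻ = (−1)^{[α_i]}χ_i⁻𝓔_i and Ω(𝓔_i)χ_i⁺ = (−1)^{[α_i]}χ_i⁺Ω(𝓔_i). -/

import Mathlib

noncomputable section

open Finset

/-- The base field `K = ℂ(v)`, with `v = q^{1/2}`. -/
abbrev KK : Type := RatFunc ℂ

/-- The variable `v = q^{1/2}`; thus `q^{a} = vv ^ (2*a)`. -/
def vv : KK := RatFunc.X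

/-- `(ε_{k+1}, ε_{k+1})` for `0 ≤ k < N` (0-indexed). -/
def epsSq (n k : ℕ) : ℤ := if k < n then -1 else 1

/-- coefficient of `ε_{k+1}` (0-indexed `k`) in the simple root `α_i`, `0 ≤ i ≤ m+n`. -/
def co (m n i k : ℕ) : ℤ :=
  if i = 0 then (if k = 0 then -2 else 0)
  else if i = m + n then (if k + 1 = m + n then 1 else 0)
  else (if k + 1 = i then 1 else 0) - (if k = i then 1 else 0)

/-- `(α_i, α_j)`. -/
def Bmat (m n i j : ℕ) : ℤ :=
  ∑ k ∈ Finset.range (m + n), epsSq n k * co m n i k * co m n j k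

/-- Bilinear form on weights written in the `α`-basis (coords `ℕ → ℤ`). -/
def Bw (m n : ℕ) (a b : ℕ → ℤ) : ℤ :=
  ∑ i ∈ Finset.range (m + n + 1), ∑ j ∈ Finset.range (m + n + 1), a i * b j * Bmat m n i j

/-- the weight `α_i` in `α`-coordinates. -/
def uw (i : ℕ) : ℕ → ℤ := fun j => if j = i then 1 else 0

/-- the sign `(-1)^{[a][b]}`: the parity of a weight `a` is `a n mod 2`. -/
def sg (n : ℕ) (a b : ℕ → ℤ) : KK := (-1 : KK) ^ (a n * b n)

/-- the coefficient `(-1)^{[a][b]} q^{-(a,b)}` appearing in `⟦·,·⟧`. -/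
def qcf (m n : ℕ) (a b : ℕ → ℤ) : KK := sg n a b * vv ^ (-2 * Bw m n a b)

/-- `q_i = vv ^ qexp i`. -/
def qexp (m n i : ℕ) : ℤ := if Bmat m n i i = 0 then 2 else |Bmat m n i i|

/-- the quantum integer `[a]_i`. -/
def qint (m n i : ℕ) (a : ℤ) : KK :=
  (vv ^ (qexp m n i * a) - vv ^ (-(qexp m n i * a))) / (vv ^ qexp m n i - vv ^ (-qexp m n i))

/-- the matrix `A_{ij}`. -/
def Amat (m n i j : ℕ) : ℤ := if i = m + n then 2 * Bmat m n i j else Bmat m n i j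

section brackets
variable {A : Type*} [Ring A] [Algebra KK A]

/-- `[x, y]_c = x y - c • (y x)`. -/
def cbr (c : KK) (x y : A) : A := x * y - c • (y * x)

/-- supercommutator of homogeneous elements of weights `a`, `b`. -/
def sbr (n : ℕ) (a b : ℕ → ℤ) (x y : A) : A := cbr (sg n a b) x y

/-- the bracket `⟦x, y⟧` for homogeneous elements of weights `a`, `b`. -/
def qbr (m n : ℕ) (a b : ℕ → ℤ) (x y : A) : A := cbr (qcf m n a b) x y

end brackets

/-- total weight of a list of simple-root indices. -/
def lwt (l : List ℕ) : ℕ → ℤ := l.foldr (fun j w => uw j + w) 0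

/-- right-nested `⟦·,⟦·,…⟧⟧` of a list of simple root vectors `e j`. -/
def qfoldr (m n : ℕ) {A : Type*} [Ring A] [Algebra KK A] (e : ℕ → A) : List ℕ → A
  | [] => 1
  | [j] => e j
  | j :: rest => qbr m n (uw j) (lwt rest) (e j) (qfoldr m n e rest)

/-! ## The Drinfeld–Jimbo presentation `U = U_q[osp(2m+1|2n)^{(1)}]` -/

/-- Generators of `U`. -/
inductive UGen (m n : ℕ) : Type
  | cp (i : Fin (m + n + 1))   -- χ_i⁺
  | cm (i : Fin (m + n + 1))   -- χ_i⁻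
  | kk (i : Fin (m + n + 1))   -- K_i
  | ki (i : Fin (m + n + 1))   -- K_i⁻¹
  | kd                          -- K_δ^{1/2}
  | kdi                         -- K_δ^{-1/2}

/-- Free algebra on the generators of `U`. -/
abbrev UF (m n : ℕ) : Type := FreeAlgebra KK (UGen m n)

def uidx (m n : ℕ) (i : ℕ) : Fin (m + n + 1) := ⟨i % (m + n + 1), Nat.mod_lt _ (Nat.succ_pos _)⟩

def fcp (m n : ℕ) (i : ℕ) : UF m n := FreeAlgebra.ι KK (UGen.cp (uidx m n i))
def fcm (m n : ℕ) (i : ℕ) : UF m n := FreeAlgebra.ι KK (UGen.cm (uidx m n i))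
def fk (m n : ℕ) (i : ℕ) : UF m n := FreeAlgebra.ι KK (UGen.kk (uidx m n i))
def fki (m n : ℕ) (i : ℕ) : UF m n := FreeAlgebra.ι KK (UGen.ki (uidx m n i))
def fkd (m n : ℕ) : UF m n := FreeAlgebra.ι KK (UGen.kd)
def fkdi (m n : ℕ) : UF m n := FreeAlgebra.ι KK (UGen.kdi)
/-- `χ_i^σ`, `σ = true` for `+`. -/
def fx (m n : ℕ) (σ : Bool) (i : ℕ) : UF m n := if σ then fcp m n i else fcm m n i

/-- left-hand side of DJ9. -/
def dj9lhs (m n : ℕ) (σ : Bool) : UF m n :=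
  sbr n (uw 3 + uw 2 + uw 1 + uw 0 + uw 1 + uw 2) (uw 1)
   (qbr m n (uw 3 + uw 2 + uw 1 + uw 0 + uw 1) (uw 2)
    (qbr m n (uw 3 + uw 2 + uw 1 + uw 0) (uw 1)
     (qbr m n (uw 3 + uw 2 + uw 1) (uw 0)
      (qbr m n (uw 3 + uw 2) (uw 1)
       (qbr m n (uw 3) (uw 2) (fx m n σ 3) (fx m n σ 2))
       (fx m n σ 1))
      (fx m n σ 0))
     (fx m n σ 1))
    (fx m n σ 2))
   (fx m n σ 1)

/-- `⟦χ_2^σ, χ_1^σ⟧`. -/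
def dj10A (m n : ℕ) (σ : Bool) : UF m n := qbr m n (uw 2) (uw 1) (fx m n σ 2) (fx m n σ 1)

/-- left-hand side of DJ10. -/
def dj10lhs (m n : ℕ) (σ : Bool) : UF m n :=
  qbr m n (uw 2 + uw 1) ((uw 2 + uw 1) + ((uw 2 + uw 1) + uw 0)) (dj10A m n σ)
   (qbr m n (uw 2 + uw 1) ((uw 2 + uw 1) + uw 0) (dj10A m n σ)
    (qbr m n (uw 2 + uw 1) (uw 0) (dj10A m n σ) (fx m n σ 0)))

/-- right-hand side of DJ10 (without the scalar). -/
def dj10rhs (m n : ℕ) (σ : Bool) : UF m n :=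
  qbr m n ((uw 2 + uw 1) + (uw 2 + (uw 2 + (uw 1 + uw 0)))) (uw 1)
   (qbr m n (uw 2 + uw 1) (uw 2 + (uw 2 + (uw 1 + uw 0))) (dj10A m n σ)
    (qbr m n (uw 2) (uw 2 + (uw 1 + uw 0)) (fx m n σ 2)
     (qbr m n (uw 2) (uw 1 + uw 0) (fx m n σ 2)
      (qbr m n (uw 1) (uw 0) (fx m n σ 1) (fx m n σ 0)))))
   (fx m n σ 1)

/-- The defining relations (DJ1)–(DJ11) of `U_q[osp(2m+1|2n)^{(1)}]`. -/
inductive URel (m n : ℕ) : UF m n → UF m n → Prop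
  | k_inv (i : ℕ) (hi : i ≤ m + n) : URel m n (fk m n i * fki m n i) 1
  | inv_k (i : ℕ) (hi : i ≤ m + n) : URel m n (fki m n i * fk m n i) 1
  | k_k (i j : ℕ) (hi : i ≤ m + n) (hj : j ≤ m + n) :
      URel m n (fk m n i * fk m n j) (fk m n j * fk m n i)
  | k_x (σ : Bool) (i j : ℕ) (hi : i ≤ m + n) (hj : j ≤ m + n) :
      URel m n (fk m n i * fx m n σ j * fki m n i)
           ((vv ^ ((if σ then 2 else -2) * Bmat m n i j)) • fx m n σ j)
  | xp_xm (i j : ℕ) (hi : i ≤ m + n) (hj : j ≤ m + n) :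
      URel m n (sbr n (uw i) (uw j) (fcp m n i) (fcm m n j))
           (if i = j then (vv ^ qexp m n i - vv ^ (-qexp m n i))⁻¹ • (fk m n i - fki m n i) else 0)
  | x_x (σ : Bool) (i j : ℕ) (hi : i ≤ m + n) (hj : j ≤ m + n) (h0 : Bmat m n i j = 0) :
      URel m n (sbr n (uw i) (uw j) (fx m n σ i) (fx m n σ j)) 0
  | serre_up (σ : Bool) (i : ℕ) (hi : i < m + n) (hn : i ≠ n) :
      URel m n (qbr m n (uw i) (uw i + uw (i+1)) (fx m n σ i)
             (qbr m n (uw i) (uw (i+1)) (fx m n σ i) (fx m n σ (i+1)))) 0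
  | serre_dn (σ : Bool) (i : ℕ) (h1 : 1 < i) (hi : i < m + n) (hn : i ≠ n) :
      URel m n (qbr m n (uw i) (uw i + uw (i-1)) (fx m n σ i)
             (qbr m n (uw i) (uw (i-1)) (fx m n σ i) (fx m n σ (i-1)))) 0
  | serre3 (σ : Bool) (i : ℕ) (hi : i = 1 ∨ i = m + n) :
      URel m n (qbr m n (uw i) (uw i + (uw i + uw (i-1))) (fx m n σ i)
             (qbr m n (uw i) (uw i + uw (i-1)) (fx m n σ i)
               (qbr m n (uw i) (uw (i-1)) (fx m n σ i) (fx m n σ (i-1))))) 0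
  | serre4 (σ : Bool) (hn : 1 < n) :
      URel m n (sbr n (uw (n-1) + uw n + uw (n+1)) (uw n)
             (qbr m n (uw (n-1) + uw n) (uw (n+1))
               (qbr m n (uw (n-1)) (uw n) (fx m n σ (n-1)) (fx m n σ n)) (fx m n σ (n+1)))
             (fx m n σ n)) 0
  | serre5 (σ : Bool) (hn : n = 1) (hm : 2 ≤ m) : URel m n (dj9lhs m n σ) 0
  | serre6 (σ : Bool) (hn : n = 1) (hm : m = 1) :
      URel m n (dj10lhs m n σ) ((1 - qint m n 1 2) • dj10rhs m n σ)
  | kd_inv : URel m n (fkd m n * fkdi m n) 1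
  | inv_kd : URel m n (fkdi m n * fkd m n) 1
  | kd_sq : URel m n (fkd m n * fkd m n)
      (fk m n 0 * ((List.range (m + n)).map (fun i => fk m n (i+1) * fk m n (i+1))).prod)
  | kd_c (y : UGen m n) : URel m n (fkd m n * FreeAlgebra.ι KK y) (FreeAlgebra.ι KK y * fkd m n)
  | kdi_c (y : UGen m n) : URel m n (fkdi m n * FreeAlgebra.ι KK y) (FreeAlgebra.ι KK y * fkdi m n)

/-- The Drinfeld–Jimbo quantum affine superalgebra `U_q[osp(2m+1|2n)^{(1)}]`. -/
abbrev UAlg (m n : ℕ) : Type := RingQuot (URel m n)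

def mkU (m n : ℕ) : UF m n →ₐ[KK] UAlg m n := RingQuot.mkAlgHom KK (URel m n)

def cp (m n : ℕ) (i : ℕ) : UAlg m n := mkU m n (fcp m n i)
def cm (m n : ℕ) (i : ℕ) : UAlg m n := mkU m n (fcm m n i)
def kU (m n : ℕ) (i : ℕ) : UAlg m n := mkU m n (fk m n i)
def kiU (m n : ℕ) (i : ℕ) : UAlg m n := mkU m n (fki m n i)
def kdU (m n : ℕ) : UAlg m n := mkU m n (fkd m n)
def kdiU (m n : ℕ) : UAlg m n := mkU m n (fkdi m n)

/-- the index sequence of the quantum root vector `𝓔_i`: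
`1, …, î, …, N, N, N-1, …, 1, 0`. -/
def eseq (m n i : ℕ) : List ℕ :=
  (((List.range (m + n)).map (· + 1)).filter (· ≠ i)) ++
    ((List.range (m + n)).map (· + 1)).reverse ++ [0]

/-- the quantum root vector `𝓔_i` (of weight `δ - α_i`). -/
def EE (m n i : ℕ) : UAlg m n := qfoldr m n (cp m n) (eseq m n i)

/-- `d_{i}` for `1 ≤ i ≤ N+1`: `(ε_i,ε_i)` for `i ≤ N`, and `d_{N+1} = 1`. -/
def dd (n i : ℕ) : ℤ := if 1 ≤ i ∧ i ≤ n then -1 else 1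

/-- The specification of the anti-automorphism `Ω` (together with the companion field
homomorphism `τ : f(v) ↦ f(v⁻¹)` of `ℂ(v)`). -/
def OmegaSpec (m n : ℕ) (τ : KK →+* KK) (Ω : UAlg m n → UAlg m n) : Prop :=
  (∀ c : ℂ, τ (algebraMap ℂ KK c) = algebraMap ℂ KK c) ∧
  τ vv = vv⁻¹ ∧
  Function.Bijective Ω ∧
  (∀ x y : UAlg m n, Ω (x + y) = Ω x + Ω y) ∧
  (∀ x y : UAlg m n, Ω (x * y) = Ω y * Ω x) ∧
  (∀ (f : KK) (x : UAlg m n), Ω (f • x) = τ f • Ω x) ∧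
  (∀ i ≤ m + n, Ω (cp m n i) = ((dd n (i+1) : ℤ) : KK) • cm m n i) ∧
  (∀ i ≤ m + n, Ω (cm m n i) = ((dd n (i+1) : ℤ) : KK) • cp m n i) ∧
  (∀ i ≤ m + n, Ω (kU m n i) = kiU m n i) ∧
  (∀ i ≤ m + n, Ω (kiU m n i) = kU m n i) ∧
  Ω (kdU m n) = kdiU m n ∧
  Ω (kdiU m n) = kdU m n

lemma co_mul_co_eq_zero {m n i j : ℕ} (k : ℕ) (h : j + 2 ≤ i) (hi : i ≤ m + n) :
    co m n i k * co m n j k = 0 := by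
  unfold co
  split_ifs <;> omega

lemma Bmat_eq_zero {m n i j : ℕ} (h : j + 2 ≤ i) (hi : i ≤ m + n) : Bmat m n i j = 0 :=
  Finset.sum_eq_zero fun k _ => by rw [mul_assoc, co_mul_co_eq_zero k h hi, mul_zero]

lemma Bmat_comm (m n i j : ℕ) : Bmat m n i j = Bmat m n j i :=
  Finset.sum_congr rfl fun k _ => by ring

lemma Bmat_odd {m n : ℕ} (hm : 1 ≤ m) (hn : 1 ≤ n) : Bmat m n n n = 0 := by
  have h : ∀ k ∈ Finset.range (m + n), epsSq n k * co m n n k * co m n n k =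
      (if k = n - 1 then -1 else 0) + (if k = n then 1 else 0) := by
    intro k _
    unfold epsSq co
    split_ifs <;> omega
  rw [Bmat, Finset.sum_congr rfl h, Finset.sum_add_distrib, Finset.sum_ite_eq',
    Finset.sum_ite_eq', if_pos (Finset.mem_range.2 (by omega)),
    if_pos (Finset.mem_range.2 (by omega))]
  norm_num

lemma Bw_add_right (m n : ℕ) (a b c : ℕ → ℤ) : Bw m n a (b + c) = Bw m n a b + Bw m n a c := by
  simp only [Bw, ← Finset.sum_add_distrib, Pi.add_apply]
  refine Finset.sum_congr rfl fun i _ => Finset.sum_congr rfl fun j _ => by ring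

lemma Bw_uw {m n i j : ℕ} (hi : i ≤ m + n) (hj : j ≤ m + n) :
    Bw m n (uw i) (uw j) = Bmat m n i j := by
  have hi' : i < m + n + 1 := by omega
  have hj' : j < m + n + 1 := by omega
  simp [Bw, uw, Finset.sum_ite_eq', hi', hj', ite_mul, mul_ite]

lemma Bw_zero_right (m n : ℕ) (a : ℕ → ℤ) : Bw m n a 0 = 0 := by
  simp [Bw]

lemma lwt_cons (j : ℕ) (l : List ℕ) : lwt (j :: l) = uw j + lwt l := rfl

lemma Bw_lwt_eq_zero {m n i : ℕ} (hi : i ≤ m + n) {l : List ℕ} (hl : ∀ j ∈ l, j + 2 ≤ i) :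
    Bw m n (uw i) (lwt l) = 0 := by
  induction l with
  | nil => exact Bw_zero_right m n _
  | cons a l ih =>
    have ha := hl a (by simp)
    rw [lwt_cons, Bw_add_right, Bw_uw hi (by omega), Bmat_eq_zero ha hi,
      ih fun j hj => hl j (by simp [hj]), add_zero]

lemma lwt_apply_eq_zero {i : ℕ} {l : List ℕ} (h : i ∉ l) : lwt l i = 0 := by
  induction l with
  | nil => rfl
  | cons a l ih =>
    simp only [List.mem_cons, not_or] at h
    rw [lwt_cons, Pi.add_apply, ih h.2, uw, if_neg h.1, add_zero]

lemma vv_ne_zero : vv ≠ 0 := RatFunc.X_ne_zero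

lemma sg_uw_eq_one {n i : ℕ} {w : ℕ → ℤ} (h : w i = 0) : sg n (uw i) w = 1 := by
  by_cases hn : n = i
  · subst hn; simp [sg, h]
  · simp [sg, uw, hn]

lemma sg_uw_uw {n i j : ℕ} (h : i ≠ j) : sg n (uw i) (uw j) = 1 :=
  sg_uw_eq_one (by simp [uw, h])

section qCommutation
variable {A : Type*} [Ring A] [Algebra KK A]

lemma cbr_mul_of_commute_up_to {c d t : KK} {x z y : A} (hx : x * y = c • (y * x))
    (hz : z * y = d • (y * z)) : cbr t x z * y = (c * d) • (y * cbr t x z) := by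
  have h1 : x * z * y = (c * d) • (y * (x * z)) := by
    rw [mul_assoc, hz, mul_smul_comm, ← mul_assoc, hx, smul_mul_assoc, smul_smul, mul_assoc,
      mul_comm d]
  have h2 : z * x * y = (c * d) • (y * (z * x)) := by
    rw [mul_assoc, hx, mul_smul_comm, ← mul_assoc, hz, smul_mul_assoc, smul_smul, mul_assoc]
  rw [cbr, sub_mul, smul_mul_assoc, h1, h2, mul_sub, mul_smul_comm, smul_sub, smul_comm t]

lemma qfoldr_cons (m n : ℕ) (e : ℕ → A) (j : ℕ) {l : List ℕ} (hl : l ≠ []) :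
    qfoldr m n e (j :: l) = qbr m n (uw j) (lwt l) (e j) (qfoldr m n e l) := by
  cases l with
  | nil => exact absurd rfl hl
  | cons => rfl

lemma qfoldr_mul {m n : ℕ} {e : ℕ → A} {y : A} {c : ℕ → KK} {l : List ℕ}
    (h : ∀ j ∈ l, e j * y = c j • (y * e j)) :
    qfoldr m n e l * y = (l.map c).prod • (y * qfoldr m n e l) := by
  induction l with
  | nil => simp [qfoldr]
  | cons a l ih =>
    rcases eq_or_ne l [] with rfl | hl
    · simpa [qfoldr] using h a (by simp)
    · rw [qfoldr_cons m n e a hl, List.map_cons, List.prod_cons]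
      exact cbr_mul_of_commute_up_to (h a (by simp)) (ih fun j hj => h j (by simp [hj]))

lemma qfoldr_mul_of_commute {m n : ℕ} {e : ℕ → A} {y : A} {l : List ℕ}
    (h : ∀ j ∈ l, e j * y = y * e j) : qfoldr m n e l * y = y * qfoldr m n e l := by
  have := qfoldr_mul (m := m) (n := n) (c := fun _ => 1) (l := l) (e := e) (y := y)
    fun j hj => by rw [one_smul, h j hj]
  simpa using this

lemma qfoldr_append_mul {m n : ℕ} {e : ℕ → A} {y : A} {s : KK} {l l' : List ℕ} (hl : l ≠ [])
    (hs : qfoldr m n e l * y = s • (y * qfoldr m n e l)) (h : ∀ j ∈ l', e j * y = y * e j) :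
    qfoldr m n e (l' ++ l) * y = s • (y * qfoldr m n e (l' ++ l)) := by
  induction l' with
  | nil => exact hs
  | cons a l' ih =>
    rw [List.cons_append, qfoldr_cons m n e a (by simp [hl])]
    have := cbr_mul_of_commute_up_to (t := qcf m n (uw a) (lwt (l' ++ l)))
      (show e a * y = (1 : KK) • (y * e a) by rw [one_smul, h a (by simp)])
      (ih fun j hj => h j (by simp [hj]))
    rwa [one_mul] at this

/-- If `x y - s y x = r (k - k')` with `k`, `k'` scaling `f` inversely, then bracketing `⟦x, f⟧`
with an element `z` that `q`-commutes with `f` kills the obstruction to commuting with `y`. -/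
lemma nested_cbr_mul {x f y z k k' : A} {r s a b c : KK}
    (hx : x * y = s • (y * x) + r • (k - k')) (hf : f * y = y * f) (hz : z * y = y * z)
    (hk : k * f = a • (f * k)) (hk' : k' * f = a⁻¹ • (f * k'))
    (hkz : k * z = b • (z * k)) (hzf : z * f = (c * b) • (f * z)) :
    cbr c z (cbr a⁻¹ x f) * y = s • (y * cbr c z (cbr a⁻¹ x f)) := by
  have hG : cbr a⁻¹ x f * y = s • (y * cbr a⁻¹ x f) + (r * (a - a⁻¹)) • (f * k) := by
    have h1 : x * f * y = s • (y * (x * f)) + r • (a • (f * k) - a⁻¹ • (f * k')) := by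
      rw [mul_assoc, hf, ← mul_assoc, hx, add_mul, smul_mul_assoc, smul_mul_assoc, sub_mul, hk,
        hk', mul_assoc]
    have h2 : f * x * y = s • (y * (f * x)) + r • (f * k - f * k') := by
      rw [mul_assoc, hx, mul_add, mul_smul_comm, mul_smul_comm, ← mul_assoc, hf, mul_sub,
        mul_assoc]
    rw [cbr, sub_mul, smul_mul_assoc, h1, h2, mul_sub y, mul_smul_comm, mul_sub r, sub_smul]
    simp only [smul_add, smul_sub, smul_smul, mul_comm a⁻¹]
    abel
  have h0 : z * (f * k) = c • (f * k * z) := by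
    rw [← mul_assoc, hzf, mul_assoc f k z, hkz, mul_smul_comm, smul_smul, smul_mul_assoc,
      mul_assoc]
  generalize cbr a⁻¹ x f = g at hG
  have h1 : z * g * y = s • (y * (z * g)) + (r * (a - a⁻¹)) • (z * (f * k)) := by
    rw [mul_assoc, hG, mul_add, mul_smul_comm, mul_smul_comm, ← mul_assoc, hz, mul_assoc]
  have h2 : g * z * y = s • (y * (g * z)) + (r * (a - a⁻¹)) • (f * k * z) := by
    rw [mul_assoc, hz, ← mul_assoc, hG, add_mul, smul_mul_assoc, smul_mul_assoc, mul_assoc y]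
  rw [cbr, sub_mul, smul_mul_assoc, h1, h2, h0, mul_sub y, mul_smul_comm, smul_add, smul_sub,
    smul_comm c s, smul_comm c (r * (a - a⁻¹))]
  abel

lemma mul_self_eq_zero_of_cbr {z : A} (h : cbr (-1) z z = 0) : z * z = 0 := by
  rw [cbr, neg_smul, one_smul, sub_neg_eq_add, ← two_smul KK] at h
  exact (smul_eq_zero_iff_right two_ne_zero).1 h

lemma cbr_cbr_self_eq_zero {z f : A} (hz : z * z = 0) (a : KK) : cbr (-a) z (cbr a z f) = 0 := by
  have h1 : z * (z * f) = 0 := by rw [← mul_assoc, hz, zero_mul]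
  have h2 : f * z * z = 0 := by rw [mul_assoc, hz, mul_zero]
  simp only [cbr, mul_sub, sub_mul, mul_smul_comm, smul_mul_assoc, h1, h2, mul_assoc z f z,
    neg_smul, smul_sub, smul_zero]
  abel

/-- If `z` commutes with `f`, the operators `⟦z, ·⟧` act on `⟦w, f⟧` through `w`. -/
lemma cbr_cbr_of_commute {z w f : A} (h : z * f = f * z) (b t : KK) :
    cbr b z (cbr t w f) = cbr t (cbr b z w) f := by
  have h1 : w * f * z = w * z * f := by rw [mul_assoc, ← h, mul_assoc]
  have h2 : z * (f * w) = f * (z * w) := by rw [← mul_assoc, h, mul_assoc]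
  simp only [cbr, mul_sub, sub_mul, mul_smul_comm, smul_mul_assoc, h1, h2, smul_sub, mul_assoc]
  rw [smul_comm t b]
  abel

end qCommutation

section relations
variable {m n : ℕ}

lemma mkU_rel {a b : UF m n} (h : URel m n a b) : mkU m n a = mkU m n b :=
  RingQuot.mkAlgHom_rel KK h

lemma mkU_sbr (a b : ℕ → ℤ) (x y : UF m n) :
    mkU m n (sbr n a b x y) = sbr n a b (mkU m n x) (mkU m n y) := by
  simp [sbr, cbr]

lemma mkU_qbr (a b : ℕ → ℤ) (x y : UF m n) :
    mkU m n (qbr m n a b x y) = qbr m n a b (mkU m n x) (mkU m n y) := by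
  simp [qbr, cbr]

lemma cp_mul_cm_of_ne {i j : ℕ} (hi : i ≤ m + n) (hj : j ≤ m + n) (h : j ≠ i) :
    cp m n j * cm m n i = cm m n i * cp m n j := by
  have := mkU_rel (URel.xp_xm j i hj hi)
  rw [mkU_sbr, sbr, sg_uw_uw h, if_neg h, map_zero, cbr, one_smul] at this
  exact sub_eq_zero.1 this

lemma cp_mul_cm_self {i : ℕ} (hi : i ≤ m + n) :
    cp m n i * cm m n i = sg n (uw i) (uw i) • (cm m n i * cp m n i) +
      (vv ^ qexp m n i - vv ^ (-qexp m n i))⁻¹ • (kU m n i - kiU m n i) := by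
  have := mkU_rel (URel.xp_xm i i hi hi)
  rw [mkU_sbr, sbr, if_pos rfl, map_smul, map_sub, cbr] at this
  exact sub_eq_iff_eq_add'.1 this

lemma cp_mul_cp_of_le {i j : ℕ} (hi : i ≤ m + n) (h : j + 2 ≤ i) :
    cp m n j * cp m n i = cp m n i * cp m n j := by
  have := mkU_rel (URel.x_x true i j hi (by omega) (Bmat_eq_zero h hi))
  rw [mkU_sbr, sbr, sg_uw_uw (by omega), map_zero, cbr, one_smul] at this
  exact (sub_eq_zero.1 this).symm

lemma cp_odd_mul_self (hm : 1 ≤ m) (hn : 1 ≤ n) : cp m n n * cp m n n = 0 := by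
  have := mkU_rel (URel.x_x true n n (by omega) (by omega) (Bmat_odd hm hn))
  have hs : sg n (uw n) (uw n) = -1 := by simp [sg, uw]
  rw [mkU_sbr, sbr, hs, map_zero] at this
  exact mul_self_eq_zero_of_cbr this

lemma kiU_mul_kU {i : ℕ} (hi : i ≤ m + n) : kiU m n i * kU m n i = 1 := by
  have := mkU_rel (URel.inv_k i hi)
  rwa [map_mul, map_one] at this

lemma kU_mul_kiU {i : ℕ} (hi : i ≤ m + n) : kU m n i * kiU m n i = 1 := by
  have := mkU_rel (URel.k_inv i hi)
  rwa [map_mul, map_one] at this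

lemma kU_mul_cp {i j : ℕ} (hi : i ≤ m + n) (hj : j ≤ m + n) :
    kU m n i * cp m n j = vv ^ (2 * Bmat m n i j) • (cp m n j * kU m n i) := by
  have := mkU_rel (URel.k_x true i j hi hj)
  rw [map_mul, map_mul, map_smul] at this
  change kU m n i * cp m n j * kiU m n i = vv ^ (2 * Bmat m n i j) • cp m n j at this
  rw [← smul_mul_assoc, ← this, mul_assoc _ (kiU m n i), kiU_mul_kU hi, mul_one]

lemma cp_mul_kU {i j : ℕ} (hi : i ≤ m + n) (hj : j ≤ m + n) :
    cp m n j * kU m n i = vv ^ (-2 * Bw m n (uw i) (uw j)) • (kU m n i * cp m n j) := by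
  rw [kU_mul_cp hi hj, smul_smul, Bw_uw hi hj, ← zpow_add₀ vv_ne_zero, neg_mul, neg_add_cancel,
    zpow_zero, one_smul]

lemma prod_map_vv_zpow (i : ℕ) (l : List ℕ) :
    (l.map fun j => vv ^ (-2 * Bw m n (uw i) (uw j))).prod =
      vv ^ (-2 * Bw m n (uw i) (lwt l)) := by
  induction l with
  | nil => simp [lwt, Bw_zero_right]
  | cons a l ih =>
    rw [List.map_cons, List.prod_cons, ih, lwt_cons, Bw_add_right, mul_add,
      zpow_add₀ vv_ne_zero]

lemma kU_mul_qfoldr {i : ℕ} (hi : i ≤ m + n) {l : List ℕ} (hl : ∀ j ∈ l, j ≤ m + n) :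
    kU m n i * qfoldr m n (cp m n) l =
      vv ^ (2 * Bw m n (uw i) (lwt l)) • (qfoldr m n (cp m n) l * kU m n i) := by
  rw [qfoldr_mul fun j hj => cp_mul_kU hi (hl j hj), prod_map_vv_zpow, smul_smul,
    ← zpow_add₀ vv_ne_zero, neg_mul, add_neg_cancel, zpow_zero, one_smul]

lemma kiU_mul_qfoldr {i : ℕ} (hi : i ≤ m + n) {l : List ℕ} (hl : ∀ j ∈ l, j ≤ m + n) :
    kiU m n i * qfoldr m n (cp m n) l =
      (vv ^ (2 * Bw m n (uw i) (lwt l)))⁻¹ • (qfoldr m n (cp m n) l * kiU m n i) := by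
  have h := kU_mul_qfoldr hi hl
  rw [eq_inv_smul_iff₀ (zpow_ne_zero _ vv_ne_zero)]
  generalize qfoldr m n (cp m n) l = f at h ⊢
  calc _ = kiU m n i * (vv ^ (2 * Bw m n (uw i) (lwt l)) • (f * kU m n i)) * kiU m n i := by
        rw [mul_smul_comm, smul_mul_assoc, mul_assoc, mul_assoc, kU_mul_kiU hi, mul_one]
    _ = f * kiU m n i := by rw [← h, ← mul_assoc, kiU_mul_kU hi, one_mul]

lemma qcf_add_right {a b : ℕ → ℤ} (c : ℕ → ℤ) (h : a n * b n = 0) :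
    qcf m n a (b + c) = vv ^ (-2 * Bw m n a b) * qcf m n a c := by
  rw [qcf, qcf, sg, sg, Pi.add_apply, mul_add, h, zero_add, Bw_add_right, mul_add,
    zpow_add₀ vv_ne_zero]
  ring

lemma uw_mul_uw_of_ne {i j : ℕ} (h : i ≠ j) (k : ℕ) : uw i k * uw j k = 0 := by
  unfold uw
  split_ifs <;> omega

/-- The obstruction to commuting with `χ_i⁻` vanishes as soon as the next bracketing generator
`χ_j⁺` annihilates the inner vector. -/
lemma qfoldr_cons_cons_mul_cm {i j : ℕ} (hi : i ≤ m + n) (hj : j ≤ m + n) (hji : j ≠ i)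
    {l : List ℕ} (hl : l ≠ []) (hlN : ∀ k ∈ l, k ≤ m + n) (hil : i ∉ l)
    (h0 : qbr m n (uw j) (lwt l) (cp m n j) (qfoldr m n (cp m n) l) = 0) :
    qfoldr m n (cp m n) (j :: i :: l) * cm m n i =
      sg n (uw i) (uw i) • (cm m n i * qfoldr m n (cp m n) (j :: i :: l)) := by
  have hc : qcf m n (uw i) (lwt l) = (vv ^ (2 * Bw m n (uw i) (lwt l)))⁻¹ := by
    rw [qcf, sg_uw_eq_one (lwt_apply_eq_zero hil), one_mul, neg_mul, zpow_neg]
  have hjF := sub_eq_zero.1 h0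
  rw [qfoldr_cons m n _ j (by simp), qfoldr_cons m n _ i hl, qbr, qbr, hc]
  refine nested_cbr_mul (cp_mul_cm_self hi)
    (qfoldr_mul_of_commute fun k hk => cp_mul_cm_of_ne hi (hlN k hk) ?_)
    (cp_mul_cm_of_ne hi hj hji) (kU_mul_qfoldr hi hlN) (kiU_mul_qfoldr hi hlN)
    (kU_mul_cp hi hj) ?_
  · rintro rfl; exact hil hk
  · rw [hjF, lwt_cons, qcf_add_right _ (uw_mul_uw_of_ne hji n), Bw_uw hj hi, Bmat_comm m n j i,
      mul_right_comm, ← zpow_add₀ vv_ne_zero, neg_mul, neg_add_cancel, zpow_zero, one_mul]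

lemma qbr_eq_zero_of_le {j : ℕ} (hj : j ≤ m + n) {l : List ℕ} (hl : ∀ k ∈ l, k + 2 ≤ j) :
    qbr m n (uw j) (lwt l) (cp m n j) (qfoldr m n (cp m n) l) = 0 := by
  have hjl : j ∉ l := fun h => by have := hl j h; omega
  rw [qbr, qcf, sg_uw_eq_one (lwt_apply_eq_zero hjl), Bw_lwt_eq_zero hj hl, mul_zero, zpow_zero,
    mul_one, cbr, one_smul,
    qfoldr_mul_of_commute fun k hk => cp_mul_cp_of_le hj (hl k hk), sub_self]

lemma qbr_odd_qbr_odd (hm : 1 ≤ m) (hn : 1 ≤ n) (w : ℕ → ℤ) (f : UAlg m n) :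
    qbr m n (uw n) (uw n + w) (cp m n n) (qbr m n (uw n) w (cp m n n) f) = 0 := by
  have h : qcf m n (uw n) (uw n + w) = -qcf m n (uw n) w := by
    rw [qcf, qcf, Bw_add_right, Bw_uw (by omega) (by omega), Bmat_odd hm hn, zero_add, sg, sg,
      Pi.add_apply, mul_add, zpow_add₀ (by norm_num)]
    simp [uw]
  rw [qbr, qbr, h]
  exact cbr_cbr_self_eq_zero (cp_odd_mul_self hm hn) _

lemma qbr_qbr_of_serre {j : ℕ} (h1 : 1 < j) (hj : j < m + n) (hjn : j ≠ n) {l : List ℕ}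
    (hl0 : l ≠ []) (hl : ∀ k ∈ l, k + 2 ≤ j) :
    qbr m n (uw j) (lwt (j :: (j - 1) :: l)) (cp m n j)
      (qfoldr m n (cp m n) (j :: (j - 1) :: l)) = 0 := by
  have hjl : lwt l j = 0 := lwt_apply_eq_zero fun h => by have := hl j h; omega
  have hc : ∀ a : ℕ → ℤ, qcf m n (uw j) (a + lwt l) = qcf m n (uw j) a := fun a => by
    have hj0 : uw j n = 0 := by simp [uw, hjn.symm]
    rw [qcf, qcf, sg, sg, Bw_add_right, Bw_lwt_eq_zero hj.le hl, hj0, add_zero, zero_mul, zero_mul]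
  have hs := mkU_rel (URel.serre_dn true j h1 hj hjn)
  rw [mkU_qbr, mkU_qbr, map_zero] at hs
  change qbr m n _ _ (cp m n j) (qbr m n _ _ (cp m n j) (cp m n (j - 1))) = 0 at hs
  have hf : cp m n j * qfoldr m n (cp m n) l = qfoldr m n (cp m n) l * cp m n j :=
    (qfoldr_mul_of_commute fun k hk => cp_mul_cp_of_le hj.le (hl k hk)).symm
  rw [qfoldr_cons m n _ j (by simp), qfoldr_cons m n _ (j - 1) hl0, lwt_cons, lwt_cons,
    ← add_assoc, qbr, qbr, qbr, hc, hc, cbr_cbr_of_commute hf, cbr_cbr_of_commute hf]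
  rw [qbr, qbr] at hs
  rw [hs]
  simp [cbr]

lemma eseq_eq {i : ℕ} (hi : i ≤ m + n) : eseq m n i =
    (((List.range (m + n)).map (· + 1)).filter (· ≠ i) ++
      ((List.range (m + n - i)).map (i + 1 + ·)).reverse) ++ i :: (List.range i).reverse := by
  have h : ((List.range (m + n)).map (· + 1)).reverse ++ [0] =
      (List.range (i + 1 + (m + n - i))).reverse := by
    rw [show i + 1 + (m + n - i) = m + n + 1 by omega, List.range_succ_eq_map, List.reverse_cons]
  rw [eseq, List.append_assoc, h, List.append_assoc]
  congr 1
  rw [List.range_add, List.reverse_append, List.range_succ, List.reverse_append]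
  rfl

lemma EE_mul_cm_of_lt {i : ℕ} (hi1 : 1 ≤ i) (hi : i < m + n) :
    EE m n i * cm m n i = sg n (uw i) (uw i) • (cm m n i * EE m n i) := by
  obtain ⟨d, hd⟩ : ∃ d, m + n - i = d + 1 := ⟨m + n - i - 1, by omega⟩
  have hmem : ∀ k ∈ (List.range i).reverse, k + 2 ≤ i + 1 := fun k hk => by
    simp at hk; omega
  rw [EE, eseq_eq hi.le, hd, List.range_succ_eq_map, List.map_cons, List.reverse_cons,
    ← List.append_assoc, List.append_assoc, List.singleton_append, add_zero]
  refine qfoldr_append_mul (by simp) (qfoldr_cons_cons_mul_cm hi.le hi (by omega) ?_ ?_ ?_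
    (qbr_eq_zero_of_le hi hmem)) ?_
  · simp; omega
  · intro k hk; have := hmem k hk; omega
  · intro hk; have := hmem i hk; omega
  · intro k hk
    have : k ≤ m + n ∧ k ≠ i := by
      simp only [List.mem_append, List.mem_reverse, List.mem_map, List.mem_filter,
        List.mem_range, decide_eq_true_eq] at hk
      obtain ⟨⟨a, ha, rfl⟩, hne⟩ | ⟨_, ⟨a, ha, rfl⟩, rfl⟩ := hk <;> constructor <;> omega
    exact cp_mul_cm_of_ne hi.le this.1 this.2

lemma EE_last_mul_cm (hm : 1 ≤ m) (hn : 1 ≤ n) :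
    EE m n (m + n) * cm m n (m + n) =
      sg n (uw (m + n)) (uw (m + n)) • (cm m n (m + n) * EE m n (m + n)) := by
  obtain ⟨j, hj⟩ : ∃ j, m + n = j + 1 + 1 := ⟨m + n - 2, by omega⟩
  have hfil : ((List.range (m + n)).map (· + 1)).filter (· ≠ m + n) =
      (List.range j).map (· + 1) ++ [j + 1] := by
    rw [hj, List.range_succ, List.range_succ]
    simp
    intro a ha; omega
  rw [EE, eseq_eq le_rfl, hfil, Nat.sub_self, List.range_zero, List.map_nil, List.reverse_nil,
    List.append_nil, List.append_assoc, List.singleton_append]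
  have hlN : ∀ k ∈ (List.range (m + n)).reverse, k < m + n := fun k hk => by simpa using hk
  refine qfoldr_append_mul (by simp) (qfoldr_cons_cons_mul_cm le_rfl (by omega) (by omega) ?_
    (fun k hk => (hlN k hk).le) (fun h => lt_irrefl _ (hlN _ h)) ?_) ?_
  · simp; omega
  · rw [hj, List.range_succ, List.reverse_append, List.reverse_singleton, List.singleton_append]
    by_cases hjn : j + 1 = n
    · rw [qfoldr_cons m n _ _ (by simp), hjn, lwt_cons]
      exact qbr_odd_qbr_odd hm hn _ _
    · rw [List.range_succ, List.reverse_append, List.reverse_singleton, List.singleton_append]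
      exact qbr_qbr_of_serre (j := j + 1) (by omega) (by omega) hjn (by simp; omega)
        (fun k hk => by simp at hk; omega)
  · intro k hk
    have : k < m + n := by
      simp at hk
      omega
    exact cp_mul_cm_of_ne le_rfl this.le this.ne

lemma sg_uw_self (i : ℕ) : sg n (uw i) (uw i) = (-1) ^ uw i n := by
  unfold sg uw
  split_ifs <;> simp

lemma EE_mul_cm (hm : 1 ≤ m) (hn : 1 ≤ n) {i : ℕ} (hi1 : 1 ≤ i) (hi : i ≤ m + n) :
    EE m n i * cm m n i = ((-1 : KK) ^ uw i n) • (cm m n i * EE m n i) := by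
  rw [← sg_uw_self]
  rcases hi.lt_or_eq with h | rfl
  · exact EE_mul_cm_of_lt hi1 h
  · exact EE_last_mul_cm hm hn

end relations

/-- in `U`, for `1 ≤ i ≤ N` the quantum root vector `𝓔_i` supercommutes
with `χ_i⁻`, and `Ω(𝓔_i)` supercommutes with `χ_i⁺`:
`𝓔_i χ_i⁻ = (-1)^{[α_i]} χ_i⁻ 𝓔_i` and `Ω(𝓔_i) χ_i⁺ = (-1)^{[α_i]} χ_i⁺ Ω(𝓔_i)`. -/
theorem root_vector_supercommutes (m n : ℕ) (hm : 1 ≤ m) (hn : 1 ≤ n)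
    (τ : KK →+* KK) (Ω : UAlg m n → UAlg m n) (hΩ : OmegaSpec m n τ Ω)
    (i : ℕ) (hi1 : 1 ≤ i) (hiN : i ≤ m + n) :
    EE m n i * cm m n i = ((-1 : KK) ^ (uw i n)) • (cm m n i * EE m n i) ∧
    Ω (EE m n i) * cp m n i = ((-1 : KK) ^ (uw i n)) • (cp m n i * Ω (EE m n i)) := by
  have h := EE_mul_cm hm hn hi1 hiN
  refine ⟨h, ?_⟩
  obtain ⟨-, -, -, -, hmul, hsmul, -, hcm, -⟩ := hΩ
  have hd : ((dd n (i + 1) : ℤ) : KK) ≠ 0 := by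
    unfold dd
    split_ifs <;> simp
  have hs : ((-1 : KK) ^ uw i n) * (-1 : KK) ^ uw i n = 1 := by
    rw [← mul_zpow]; simp
  have hΩh := congrArg Ω h
  rw [hsmul, hmul, hmul, hcm i hiN, map_zpow₀, map_neg, map_one, smul_mul_assoc, mul_smul_comm,
    smul_comm, smul_right_inj hd] at hΩh
  rw [hΩh, smul_smul, hs, one_smul]
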